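/- Let μ ∈ ℝ, let G, H : [0,1] → ℝ be nonnegative and integrable, let a, b, c : [0,1] → [0,1] be measurable, and define λ(n) = ∫₀¹ G(s)(1 - a(s)^n - b(s)^n) ds + ∫₀¹ H(s)(1 - c(s)^n) ds and 𝒢(k,l) = C(k+l, k) ∫₀¹ G(s) a(s)^k b(s)^l ds (binomial coefficient C(k+l,k)). Suppose ψ : ℝ → ℝ is infinitely differentiable on a neighborhood of 0 with ψ(0) = 1 and satisfies, for all x ≥ 0, -μ x ψ'(x) = ∫₀¹ G(s)[ψ(a(s)x)ψ(b(s)x) - ψ(x)]ds + ∫₀¹ H(s)[ψ(c(s)x) - ψ(x)]ds. Setting ψ_n = (-1)^n ψ^{(n)}(0), the following hold: ψ₁ (μ - λ(1)) = 0, and for every n ≥ 2, ψ_n (μ n - λ(n)) + Σ_{k=1}^{n-1} 𝒢(k, n-k) ψ_k ψ_{n-k} = 0. -/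

import Mathlib

open Real MeasureTheory

/-- A real polynomial that is `O(x ^ n)` as `x → 0⁺` is divisible by `X ^ n`. -/
theorem X_pow_dvd_of_abs_eval_le {δ C : ℝ} (hδ : 0 < δ) (n : ℕ) (Q : Polynomial ℝ)
    (hQ : ∀ x ∈ Set.Ioc 0 δ, |Q.eval x| ≤ C * x ^ n) : Polynomial.X ^ n ∣ Q := by
  induction n generalizing Q with
  | zero => simp
  | succ n ih =>
    have hev : ∀ᶠ x in nhdsWithin (0 : ℝ) (Set.Ioi 0), |Q.eval x| ≤ C * x ^ (n + 1) := by
      filter_upwards [Ioc_mem_nhdsGT hδ] with x hx using hQ x hx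
    have hleft : Filter.Tendsto (fun x => |Q.eval x|) (nhdsWithin (0 : ℝ) (Set.Ioi 0))
        (nhds |Q.eval 0|) :=
      (Q.continuous.abs.tendsto 0).mono_left nhdsWithin_le_nhds
    have hright : Filter.Tendsto (fun x : ℝ => C * x ^ (n + 1))
        (nhdsWithin (0 : ℝ) (Set.Ioi 0)) (nhds (C * 0 ^ (n + 1))) :=
      ((by fun_prop : Continuous fun x : ℝ => C * x ^ (n + 1)).tendsto 0).mono_left
        nhdsWithin_le_nhds
    have h0 : Q.eval 0 = 0 := by
      have := le_of_tendsto_of_tendsto hleft hright hev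
      simpa using this
    have hX : Polynomial.X ∣ Q := by
      rw [Polynomial.X_dvd_iff, Polynomial.coeff_zero_eq_eval_zero, h0]
    obtain ⟨R, rfl⟩ := hX
    rw [pow_succ']
    refine mul_dvd_mul_left _ (ih R fun x hx => ?_)
    have h := hQ x hx
    rw [Polynomial.eval_mul, Polynomial.eval_X, abs_mul, abs_of_pos hx.1, pow_succ] at h
    refine le_of_mul_le_mul_left (h.trans_eq ?_) hx.1
    ring

/-- The degree `2 * n` polynomial in `x` obtained from `∫ g * (T (a x) * T (b x) - T x)` for
`T = ∑ k ≤ n, p k * X ^ k`. -/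
noncomputable def gainLossPoly {Ω : Type*} [MeasurableSpace Ω] (ν : Measure Ω) (g a b : Ω → ℝ)
    (p : ℕ → ℝ) (n : ℕ) : Polynomial ℝ :=
  ∑ i ∈ Finset.range (n + 1), ∑ j ∈ Finset.range (n + 1),
      Polynomial.monomial (i + j) (p i * p j * ∫ s, g s * (a s ^ i * b s ^ j) ∂ν)
    - ∑ i ∈ Finset.range (n + 1), Polynomial.monomial i (p i * ∫ s, g s ∂ν)

theorem coeff_gainLossPoly {Ω : Type*} [MeasurableSpace Ω] (ν : Measure Ω) (g a b : Ω → ℝ)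
    (p : ℕ → ℝ) (n : ℕ) :
    (gainLossPoly ν g a b p n).coeff n
      = ∑ i ∈ Finset.range (n + 1), p i * p (n - i) * ∫ s, g s * (a s ^ i * b s ^ (n - i)) ∂ν
        - p n * ∫ s, g s ∂ν := by
  simp only [gainLossPoly, Polynomial.coeff_sub, Polynomial.finsetSum_coeff,
    Polynomial.coeff_monomial]
  congr 1
  · refine Finset.sum_congr rfl fun i hi => ?_
    have hi := Finset.mem_range.1 hi
    rw [Finset.sum_eq_single (n - i)]
    · rw [if_pos (by omega)]
    · intro j _ hj
      rw [if_neg (by omega)]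
    · intro h
      exact absurd (Finset.mem_range.2 (by omega)) h
  · simp

theorem integrable_mul_of_abs_le {Ω : Type*} [MeasurableSpace Ω] {ν : Measure Ω} {g f : Ω → ℝ}
    (hg : Integrable g ν) (hf : Measurable f) {M : ℝ} (hM : ∀ᵐ s ∂ν, |f s| ≤ M) :
    Integrable (fun s => g s * f s) ν :=
  hg.mul_bdd hf.aestronglyMeasurable hM

theorem abs_pow_mul_pow_le_one {u v : ℝ} (hu : u ∈ Set.Icc (0 : ℝ) 1)
    (hv : v ∈ Set.Icc (0 : ℝ) 1) (i j : ℕ) : |u ^ i * v ^ j| ≤ 1 := by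
  rw [abs_of_nonneg (mul_nonneg (pow_nonneg hu.1 i) (pow_nonneg hv.1 j))]
  exact mul_le_one₀ (pow_le_one₀ hu.1 hu.2) (pow_nonneg hv.1 j) (pow_le_one₀ hv.1 hv.2)

theorem eval_gainLossPoly {Ω : Type*} [MeasurableSpace Ω] {ν : Measure Ω} {g a b : Ω → ℝ}
    (hg : Integrable g ν) (ha : Measurable a) (hb : Measurable b)
    (ha1 : ∀ᵐ s ∂ν, a s ∈ Set.Icc (0 : ℝ) 1) (hb1 : ∀ᵐ s ∂ν, b s ∈ Set.Icc (0 : ℝ) 1)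
    (p : ℕ → ℝ) (n : ℕ) (x : ℝ) :
    Integrable (fun s => g s * ((∑ i ∈ Finset.range (n + 1), p i * (a s * x) ^ i)
        * (∑ j ∈ Finset.range (n + 1), p j * (b s * x) ^ j)
        - ∑ i ∈ Finset.range (n + 1), p i * x ^ i)) ν ∧
    ∫ s, g s * ((∑ i ∈ Finset.range (n + 1), p i * (a s * x) ^ i)
        * (∑ j ∈ Finset.range (n + 1), p j * (b s * x) ^ j)
        - ∑ i ∈ Finset.range (n + 1), p i * x ^ i) ∂ν
      = (gainLossPoly ν g a b p n).eval x := by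
  have hab : ∀ i j, Integrable (fun s => g s * (a s ^ i * b s ^ j)) ν := fun i j =>
    integrable_mul_of_abs_le (M := 1) hg (by fun_prop) (by
      filter_upwards [ha1, hb1] with s h1 h2 using abs_pow_mul_pow_le_one h1 h2 i j)
  have hexp : (fun s => g s * ((∑ i ∈ Finset.range (n + 1), p i * (a s * x) ^ i)
        * (∑ j ∈ Finset.range (n + 1), p j * (b s * x) ^ j)
        - ∑ i ∈ Finset.range (n + 1), p i * x ^ i))
      = fun s => (∑ i ∈ Finset.range (n + 1), ∑ j ∈ Finset.range (n + 1),
          p i * p j * x ^ (i + j) * (g s * (a s ^ i * b s ^ j)))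
        - (∑ i ∈ Finset.range (n + 1), p i * x ^ i) * g s := by
    funext s
    rw [Finset.sum_mul_sum, mul_sub, mul_comm (g s) (∑ i ∈ Finset.range (n + 1), p i * x ^ i),
      Finset.mul_sum]
    congr 1
    refine Finset.sum_congr rfl fun i _ => ?_
    rw [Finset.mul_sum]
    refine Finset.sum_congr rfl fun j _ => ?_
    rw [mul_pow, mul_pow, pow_add]
    ring
  have hin : ∀ i ∈ Finset.range (n + 1), ∀ j ∈ Finset.range (n + 1),
      Integrable (fun s => p i * p j * x ^ (i + j) * (g s * (a s ^ i * b s ^ j))) ν :=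
    fun i _ j _ => (hab i j).const_mul _
  have hsum : ∀ i ∈ Finset.range (n + 1), Integrable (fun s => ∑ j ∈ Finset.range (n + 1),
      p i * p j * x ^ (i + j) * (g s * (a s ^ i * b s ^ j))) ν :=
    fun i hi => integrable_finsetSum _ (hin i hi)
  rw [hexp]
  refine ⟨(integrable_finsetSum _ hsum).sub (hg.const_mul _), ?_⟩
  rw [integral_sub (integrable_finsetSum _ hsum) (hg.const_mul _), integral_finsetSum _ hsum,
    integral_const_mul, gainLossPoly, Polynomial.eval_sub, Polynomial.eval_finsetSum,
    Polynomial.eval_finsetSum, Finset.sum_mul]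
  congr 1
  · refine Finset.sum_congr rfl fun i hi => ?_
    rw [integral_finsetSum _ (hin i hi), Polynomial.eval_finsetSum]
    refine Finset.sum_congr rfl fun j _ => ?_
    rw [integral_const_mul, Polynomial.eval_monomial]
    ring
  · refine Finset.sum_congr rfl fun i _ => ?_
    rw [Polynomial.eval_monomial]
    ring

/-- If `φ` agrees with `∑ k ≤ n, p k * x ^ k` up to `O(x ^ (n + 1))`, then the gain-loss integral
of `φ` agrees with `gainLossPoly` up to `O(x ^ (n + 1))`. -/
theorem exists_abs_integral_sub_gainLossPoly_le {Ω : Type*} [MeasurableSpace Ω] {ν : Measure Ω}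
    {g a b : Ω → ℝ} (hg : Integrable g ν) (ha : Measurable a) (hb : Measurable b)
    (ha1 : ∀ᵐ s ∂ν, a s ∈ Set.Icc (0 : ℝ) 1) (hb1 : ∀ᵐ s ∂ν, b s ∈ Set.Icc (0 : ℝ) 1)
    {φ : ℝ → ℝ} (hφ : Continuous φ) {p : ℕ → ℝ} {n : ℕ} {δ C : ℝ}
    (hT : ∀ x ∈ Set.Icc 0 δ,
      |φ x - ∑ i ∈ Finset.range (n + 1), p i * x ^ i| ≤ C * x ^ (n + 1)) :
    ∃ K, ∀ x ∈ Set.Icc 0 δ,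
      |∫ s, g s * (φ (a s * x) * φ (b s * x) - φ x) ∂ν - (gainLossPoly ν g a b p n).eval x|
        ≤ K * x ^ (n + 1) := by
  set T : ℝ → ℝ := fun x => ∑ i ∈ Finset.range (n + 1), p i * x ^ i with hTdef
  have hTc : Continuous T := by fun_prop
  obtain ⟨M₁, hM₁⟩ := isCompact_Icc.exists_bound_of_continuousOn (s := Set.Icc 0 δ)
    hφ.continuousOn
  obtain ⟨M₂, hM₂⟩ := isCompact_Icc.exists_bound_of_continuousOn (s := Set.Icc 0 δ)
    hTc.continuousOn
  refine ⟨(|C| * M₁ + M₂ * |C| + |C|) * ∫ s, |g s| ∂ν, fun x hx => ?_⟩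
  have hscale : ∀ u ∈ Set.Icc (0 : ℝ) 1, u * x ∈ Set.Icc 0 δ := fun u hu =>
    ⟨mul_nonneg hu.1 hx.1, (mul_le_of_le_one_left hx.1 hu.2).trans hx.2⟩
  have hR : ∀ u ∈ Set.Icc (0 : ℝ) 1, |φ (u * x) - T (u * x)| ≤ |C| * x ^ (n + 1) := by
    intro u hu
    refine (hT _ (hscale u hu)).trans ?_
    have h1 := (hscale u hu).1
    have h2 : (u * x) ^ (n + 1) ≤ x ^ (n + 1) :=
      pow_le_pow_left₀ h1 (mul_le_of_le_one_left hx.1 hu.2) _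
    exact mul_le_mul (le_abs_self C) h2 (pow_nonneg h1 _) (abs_nonneg C)
  have hφint : Integrable (fun s => g s * (φ (a s * x) * φ (b s * x) - φ x)) ν := by
    have hm := hφ.measurable
    refine integrable_mul_of_abs_le (M := M₁ * M₁ + M₁) hg (by fun_prop) ?_
    filter_upwards [ha1, hb1] with s h1 h2
    have e1 := hM₁ _ (hscale _ h1)
    have e2 := hM₁ _ (hscale _ h2)
    have e3 := hM₁ _ hx
    rw [Real.norm_eq_abs] at e1 e2 e3
    refine (abs_sub _ _).trans (add_le_add ?_ e3)
    rw [abs_mul]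
    exact mul_le_mul e1 e2 (abs_nonneg _) ((abs_nonneg _).trans e1)
  obtain ⟨hTint, hTeval⟩ := eval_gainLossPoly hg ha hb ha1 hb1 p n x
  rw [← hTeval, ← integral_sub hφint hTint, ← Real.norm_eq_abs, mul_assoc,
    mul_comm (∫ s, |g s| ∂ν), ← mul_assoc, ← integral_const_mul]
  refine norm_integral_le_of_norm_le (hg.abs.const_mul _) ?_
  filter_upwards [ha1, hb1] with s h1 h2
  have e1 := hM₁ _ (hscale _ h2)
  have e2 := hM₂ _ (hscale _ h1)
  have e3 := hR _ h1
  have e4 := hR _ h2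
  have e5 := hR 1 (by simp)
  rw [one_mul] at e5
  rw [Real.norm_eq_abs] at e1 e2
  change ‖g s * (φ (a s * x) * φ (b s * x) - φ x)
    - g s * (T (a s * x) * T (b s * x) - T x)‖ ≤ _
  have hsplit : g s * (φ (a s * x) * φ (b s * x) - φ x)
      - g s * (T (a s * x) * T (b s * x) - T x)
      = ((φ (a s * x) - T (a s * x)) * φ (b s * x)
        + T (a s * x) * (φ (b s * x) - T (b s * x)) - (φ x - T x)) * g s := by ring
  rw [hsplit, Real.norm_eq_abs, abs_mul]
  refine mul_le_mul_of_nonneg_right ?_ (abs_nonneg _)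
  have hxn : 0 ≤ |C| * x ^ (n + 1) := (abs_nonneg _).trans e5
  calc _ ≤ |φ (a s * x) - T (a s * x)| * |φ (b s * x)|
        + |T (a s * x)| * |φ (b s * x) - T (b s * x)| + |φ x - T x| := by
        rw [← abs_mul, ← abs_mul]
        exact (abs_sub _ _).trans (add_le_add_left (abs_add_le _ _) _)
    _ ≤ (|C| * x ^ (n + 1)) * M₁ + M₂ * (|C| * x ^ (n + 1)) + |C| * x ^ (n + 1) :=
        add_le_add (add_le_add (mul_le_mul e3 e1 (abs_nonneg _) hxn)
          (mul_le_mul e2 e4 (abs_nonneg _) ((abs_nonneg _).trans e2))) e5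
    _ = _ := by ring

/-- Taylor expansion at `0`, to the right, of a function smooth near `[0, δ]`. -/
theorem exists_abs_sub_taylor_le {f : ℝ → ℝ} {δ : ℝ} (hδ : 0 < δ)
    (hf : ∀ x ∈ Set.Icc 0 δ, ContDiffAt ℝ (⊤ : ℕ∞) f x) (n : ℕ) :
    ∃ C, ∀ x ∈ Set.Icc 0 δ,
      |f x - ∑ i ∈ Finset.range (n + 1), iteratedDeriv i f 0 / (i.factorial : ℝ) * x ^ i|
        ≤ C * x ^ (n + 1) := by
  have hle : ∀ m : ℕ, (m : WithTop ℕ∞) ≤ ((⊤ : ℕ∞) : WithTop ℕ∞) := fun m =>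
    WithTop.coe_le_coe.2 le_top
  obtain ⟨C, hC⟩ := exists_taylor_mean_remainder_bound (n := n) hδ.le
    (fun x hx => ((hf x hx).of_le (by exact_mod_cast hle (n + 1))).contDiffWithinAt)
  refine ⟨C, fun x hx => ?_⟩
  have h := hC x hx
  rw [taylor_within_apply, sub_zero, Real.norm_eq_abs] at h
  convert h using 4 with i hi
  have h0 : (0 : ℝ) ∈ Set.Icc 0 δ := ⟨le_rfl, hδ.le⟩
  rw [iteratedDerivWithin_eq_iteratedDeriv (uniqueDiffOn_Icc hδ) ((hf 0 h0).of_le (hle i)) h0,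
    smul_eq_mul]
  ring

/-- The identity obtained by comparing the coefficients of `x ^ (m + 1)` in the profile
equation. -/
theorem profile_coeff_identity {Ω : Type*} [MeasurableSpace Ω] {ν : Measure Ω}
    {G H a b c : Ω → ℝ} (hG : Integrable G ν) (hH : Integrable H ν)
    (ha : Measurable a) (hb : Measurable b) (hc : Measurable c)
    (ha1 : ∀ᵐ s ∂ν, a s ∈ Set.Icc (0 : ℝ) 1) (hb1 : ∀ᵐ s ∂ν, b s ∈ Set.Icc (0 : ℝ) 1)
    (hc1 : ∀ᵐ s ∂ν, c s ∈ Set.Icc (0 : ℝ) 1) {μ δ : ℝ} (hδ : 0 < δ) {ψ : ℝ → ℝ}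
    (hsmooth : ∀ x ∈ Set.Icc 0 δ, ContDiffAt ℝ (⊤ : ℕ∞) ψ x) (hψ0 : ψ 0 = 1)
    (hψ : ∀ x ∈ Set.Icc 0 δ, -μ * x * deriv ψ x
      = ∫ s, G s * (ψ (a s * x) * ψ (b s * x) - ψ x) ∂ν + ∫ s, H s * (ψ (c s * x) - ψ x) ∂ν)
    {p : ℕ → ℝ} (hp : ∀ k, p k = iteratedDeriv k ψ 0 / (k.factorial : ℝ)) (m : ℕ) :
    μ * ((m + 1 : ℕ) * p (m + 1))
      + (∑ i ∈ Finset.range (m + 2),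
          p i * p (m + 1 - i) * ∫ s, G s * (a s ^ i * b s ^ (m + 1 - i)) ∂ν
        - p (m + 1) * ∫ s, G s ∂ν)
      + (p (m + 1) * ∫ s, H s * c s ^ (m + 1) ∂ν - p (m + 1) * ∫ s, H s ∂ν) = 0 := by
  have h0 : (0 : ℝ) ∈ Set.Icc 0 δ := ⟨le_rfl, hδ.le⟩
  set φ : ℝ → ℝ := Set.IccExtend hδ.le (fun y => ψ y) with hφdef
  have hφψ : ∀ x ∈ Set.Icc 0 δ, φ x = ψ x := fun x hx => Set.IccExtend_of_mem hδ.le _ hx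
  have hφ : Continuous φ := by
    refine Continuous.Icc_extend' ?_
    exact continuousOn_iff_continuous_domRestrict.1
      fun x hx => (hsmooth x hx).continuousAt.continuousWithinAt
  have hp0 : p 0 = 1 := by simp [hp, hψ0]
  obtain ⟨C, hC⟩ := exists_abs_sub_taylor_le hδ hsmooth (m + 1)
  have hT : ∀ x ∈ Set.Icc 0 δ,
      |φ x - ∑ i ∈ Finset.range (m + 1 + 1), p i * x ^ i| ≤ C * x ^ (m + 1 + 1) := by
    intro x hx
    simpa only [hφψ x hx, hp] using hC x hx
  have hderiv : ∀ x ∈ Set.Icc 0 δ, ContDiffAt ℝ (⊤ : ℕ∞) (deriv ψ) x := fun x hx =>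
    (hsmooth x hx).derivWithin (by simp)
  obtain ⟨D, hD⟩ := exists_abs_sub_taylor_le hδ hderiv m
  obtain ⟨K₁, hK₁⟩ := exists_abs_integral_sub_gainLossPoly_le hG ha hb ha1 hb1 hφ hT
  obtain ⟨K₂, hK₂⟩ := exists_abs_integral_sub_gainLossPoly_le (b := fun _ => 0) hH hc
    measurable_const hc1 (by simp) hφ hT
  set P : Polynomial ℝ := ∑ k ∈ Finset.range (m + 1),
    Polynomial.monomial (k + 1) (((k + 1 : ℕ) : ℝ) * p (k + 1)) with hPdef
  have hP : ∀ x ∈ Set.Icc 0 δ, |x * deriv ψ x - P.eval x| ≤ D * x ^ (m + 2) := by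
    intro x hx
    have hPx : P.eval x = x * ∑ i ∈ Finset.range (m + 1),
        iteratedDeriv i (deriv ψ) 0 / (i.factorial : ℝ) * x ^ i := by
      rw [hPdef, Polynomial.eval_finsetSum, Finset.mul_sum]
      refine Finset.sum_congr rfl fun i _ => ?_
      have : (i.factorial : ℝ) ≠ 0 := by positivity
      rw [Polynomial.eval_monomial, hp, ← iteratedDeriv_succ', Nat.factorial_succ]
      push_cast
      field_simp
      ring
    rw [hPx, ← mul_sub, abs_mul, abs_of_nonneg hx.1]
    calc _ ≤ x * (D * x ^ (m + 1)) := mul_le_mul_of_nonneg_left (hD x hx) hx.1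
      _ = _ := by ring
  set Q := Polynomial.C μ * P + gainLossPoly ν G a b p (m + 1)
    + gainLossPoly ν H c (fun _ => 0) p (m + 1) with hQdef
  have hQ : ∀ x ∈ Set.Ioc 0 δ, |Q.eval x| ≤ (|μ| * D + K₁ + K₂) * x ^ (m + 2) := by
    intro x hx'
    have hx : x ∈ Set.Icc 0 δ := ⟨hx'.1.le, hx'.2⟩
    have hscale : ∀ u ∈ Set.Icc (0 : ℝ) 1, u * x ∈ Set.Icc 0 δ := fun u hu =>
      ⟨mul_nonneg hu.1 hx.1, (mul_le_of_le_one_left hx.1 hu.2).trans hx.2⟩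
    have hGφ : ∫ s, G s * (ψ (a s * x) * ψ (b s * x) - ψ x) ∂ν
        = ∫ s, G s * (φ (a s * x) * φ (b s * x) - φ x) ∂ν := by
      refine integral_congr_ae ?_
      filter_upwards [ha1, hb1] with s h1 h2
      rw [hφψ _ hx, hφψ _ (hscale _ h1), hφψ _ (hscale _ h2)]
    have hHφ : ∫ s, H s * (ψ (c s * x) - ψ x) ∂ν
        = ∫ s, H s * (φ (c s * x) * φ (0 * x) - φ x) ∂ν := by
      refine integral_congr_ae ?_
      filter_upwards [hc1] with s h1
      rw [hφψ _ hx, hφψ _ (hscale _ h1), zero_mul, hφψ _ h0, hψ0, mul_one]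
    have heq := hψ x hx
    rw [hGφ, hHφ] at heq
    have e1 := hP x hx
    have e2 := hK₁ x hx
    have e3 := hK₂ x hx
    have hsplit : Q.eval x = -(μ * (x * deriv ψ x - P.eval x)
        + (∫ s, G s * (φ (a s * x) * φ (b s * x) - φ x) ∂ν
          - (gainLossPoly ν G a b p (m + 1)).eval x)
        + (∫ s, H s * (φ (c s * x) * φ (0 * x) - φ x) ∂ν
          - (gainLossPoly ν H c (fun _ => 0) p (m + 1)).eval x)) := by
      simp only [hQdef, Polynomial.eval_add, Polynomial.eval_mul, Polynomial.eval_C]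
      linear_combination -heq
    rw [hsplit, abs_neg]
    calc _ ≤ |μ| * (D * x ^ (m + 2)) + K₁ * x ^ (m + 1 + 1) + K₂ * x ^ (m + 1 + 1) := by
          refine (abs_add_three _ _ _).trans (add_le_add (add_le_add ?_ e2) e3)
          rw [abs_mul]
          exact mul_le_mul_of_nonneg_left e1 (abs_nonneg _)
      _ = _ := by ring
  have hcoeff := Polynomial.X_pow_dvd_iff.1 (X_pow_dvd_of_abs_eval_le hδ _ Q hQ) (m + 1)
    (by omega)
  have hPc : P.coeff (m + 1) = (m + 1 : ℕ) * p (m + 1) := by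
    simp [hPdef, Polynomial.finsetSum_coeff, Polynomial.coeff_monomial]
  rw [hQdef, Polynomial.coeff_add, Polynomial.coeff_add, Polynomial.coeff_C_mul, hPc,
    coeff_gainLossPoly, coeff_gainLossPoly] at hcoeff
  rw [← hcoeff]
  congr 2
  rw [Finset.sum_eq_single (m + 1)]
  · simp [hp0]
  · intro i hi hne
    have := Finset.mem_range.1 hi
    simp [zero_pow (show m + 1 - i ≠ 0 by omega)]
  · simp

/-- The moment recursion: if `ψ` is smooth near `0`, `ψ(0) = 1`, and `ψ` solves the
generalized self-similar profile equation, then the Taylor coefficients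
`ψ_n = (-1)^n ψ^{(n)}(0)` satisfy `ψ₁(μ - λ(1)) = 0` and, for `n ≥ 2`,
`ψ_n (μ n - λ(n)) + Σ_{k=1}^{n-1} 𝒢(k, n-k) ψ_k ψ_{n-k} = 0`. -/
theorem stmt17 (μ : ℝ)
    (G H a b c : ℝ → ℝ)
    (hG : ∀ s ∈ Set.Icc (0 : ℝ) 1, 0 ≤ G s)
    (hH : ∀ s ∈ Set.Icc (0 : ℝ) 1, 0 ≤ H s)
    (hGint : IntervalIntegrable G MeasureTheory.volume 0 1)
    (hHint : IntervalIntegrable H MeasureTheory.volume 0 1)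
    (ha : Measurable a) (hb : Measurable b) (hc : Measurable c)
    (ha1 : ∀ s ∈ Set.Icc (0 : ℝ) 1, a s ∈ Set.Icc (0 : ℝ) 1)
    (hb1 : ∀ s ∈ Set.Icc (0 : ℝ) 1, b s ∈ Set.Icc (0 : ℝ) 1)
    (hc1 : ∀ s ∈ Set.Icc (0 : ℝ) 1, c s ∈ Set.Icc (0 : ℝ) 1)
    (lam : ℕ → ℝ)
    (hlam : ∀ n : ℕ, lam n
      = (∫ s in (0 : ℝ)..1, G s * (1 - a s ^ n - b s ^ n))
        + ∫ s in (0 : ℝ)..1, H s * (1 - c s ^ n))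
    (𝒢 : ℕ → ℕ → ℝ)
    (h𝒢 : ∀ k l : ℕ, 𝒢 k l
      = (Nat.choose (k + l) k : ℝ) * ∫ s in (0 : ℝ)..1, G s * a s ^ k * b s ^ l)
    (ψ : ℝ → ℝ)
    (hsmooth : ∃ U ∈ nhds (0 : ℝ), ContDiffOn ℝ (⊤ : ℕ∞) ψ U)
    (hψ0 : ψ 0 = 1)
    (hψ : ∀ x : ℝ, 0 ≤ x →
      -μ * x * deriv ψ x
        = (∫ s in (0 : ℝ)..1, G s * (ψ (a s * x) * ψ (b s * x) - ψ x))
          + ∫ s in (0 : ℝ)..1, H s * (ψ (c s * x) - ψ x))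
    (ψn : ℕ → ℝ)
    (hψn : ∀ n : ℕ, ψn n = (-1 : ℝ) ^ n * iteratedDeriv n ψ 0) :
    ψn 1 * (μ - lam 1) = 0 ∧
    ∀ n : ℕ, 2 ≤ n →
      ψn n * (μ * n - lam n)
        + ∑ k ∈ Finset.Ico 1 n, 𝒢 k (n - k) * ψn k * ψn (n - k) = 0 := by
  have hIoc : ∀ᵐ s ∂(volume.restrict (Set.Ioc (0 : ℝ) 1)), s ∈ Set.Icc (0 : ℝ) 1 := by
    filter_upwards [ae_restrict_mem measurableSet_Ioc] with s hs using Set.Ioc_subset_Icc_self hs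
  have hGi : Integrable G (volume.restrict (Set.Ioc (0 : ℝ) 1)) :=
    (intervalIntegrable_iff_integrableOn_Ioc_of_le zero_le_one).1 hGint
  have hHi : Integrable H (volume.restrict (Set.Ioc (0 : ℝ) 1)) :=
    (intervalIntegrable_iff_integrableOn_Ioc_of_le zero_le_one).1 hHint
  have ha2 := hIoc.mono ha1
  have hb2 := hIoc.mono hb1
  have hc2 := hIoc.mono hc1
  obtain ⟨U, hU, hψU⟩ := hsmooth
  obtain ⟨ε, hε, hεU⟩ := Metric.mem_nhds_iff.1 hU
  have hδ : 0 < ε / 2 := by positivity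
  have hat : ∀ x ∈ Set.Icc 0 (ε / 2), ContDiffAt ℝ (⊤ : ℕ∞) ψ x := by
    intro x hx
    refine hψU.contDiffAt (Filter.mem_of_superset (Metric.isOpen_ball.mem_nhds ?_) hεU)
    rw [Metric.mem_ball, Real.dist_eq, sub_zero, abs_of_nonneg hx.1]
    linarith [hx.2]
  simp only [intervalIntegral.integral_of_le zero_le_one] at hlam h𝒢 hψ
  set p : ℕ → ℝ := fun k => iteratedDeriv k ψ 0 / (k.factorial : ℝ) with hp
  have hp0 : p 0 = 1 := by simp [hp, hψ0]
  have hψp : ∀ k, ψn k = (-1) ^ k * (k.factorial * p k) := by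
    intro k
    rw [hψn, hp]
    have : (k.factorial : ℝ) ≠ 0 := by positivity
    field_simp
  have hpow : ∀ {g u : ℝ → ℝ}, Integrable g (volume.restrict (Set.Ioc (0 : ℝ) 1)) →
      Measurable u → (∀ᵐ s ∂(volume.restrict (Set.Ioc (0 : ℝ) 1)), u s ∈ Set.Icc (0 : ℝ) 1) →
      ∀ n : ℕ, Integrable (fun s => g s * u s ^ n) (volume.restrict (Set.Ioc (0 : ℝ) 1)) := by
    intro g u hg hu hu1 n
    refine integrable_mul_of_abs_le (M := 1) hg (by fun_prop) ?_
    filter_upwards [hu1] with s hs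
    simpa using abs_pow_mul_pow_le_one hs hs n 0
  have hrec : ∀ n : ℕ, 1 ≤ n → ψn n * (μ * n - lam n)
      + ∑ k ∈ Finset.Ico 1 n, 𝒢 k (n - k) * ψn k * ψn (n - k) = 0 := by
    intro n hn
    obtain ⟨m, rfl⟩ := Nat.exists_eq_add_of_le' hn
    have key := profile_coeff_identity hGi hHi ha hb hc ha2 hb2 hc2 hδ hat hψ0
      (fun x hx => hψ x hx.1) (p := p) (fun _ => rfl) m
    have hlam' : lam (m + 1)
        = ((∫ s in Set.Ioc 0 1, G s) - (∫ s in Set.Ioc 0 1, G s * a s ^ (m + 1))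
        - ∫ s in Set.Ioc 0 1, G s * b s ^ (m + 1))
        + ((∫ s in Set.Ioc 0 1, H s) - ∫ s in Set.Ioc 0 1, H s * c s ^ (m + 1)) := by
      have hGa : Integrable (fun s => G s - G s * a s ^ (m + 1))
          (volume.restrict (Set.Ioc (0 : ℝ) 1)) := hGi.sub (hpow hGi ha ha2 _)
      rw [hlam]
      simp only [mul_sub, mul_one]
      rw [integral_sub hGa (hpow hGi hb hb2 _),
        integral_sub hGi (hpow hGi ha ha2 _), integral_sub hHi (hpow hHi hc hc2 _)]
    have hsum : ∑ k ∈ Finset.Ico 1 (m + 1), 𝒢 k (m + 1 - k) * ψn k * ψn (m + 1 - k)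
        = (-1) ^ (m + 1) * (m + 1).factorial * ∑ k ∈ Finset.Ico 1 (m + 1), p k * p (m + 1 - k)
          * ∫ s in Set.Ioc 0 1, G s * (a s ^ k * b s ^ (m + 1 - k)) := by
      rw [Finset.mul_sum]
      refine Finset.sum_congr rfl fun k hk => ?_
      have hkn : k ≤ m + 1 := (Finset.mem_Ico.1 hk).2.le
      rw [h𝒢, hψp, hψp, Nat.add_sub_cancel' hkn, ← Nat.choose_mul_factorial_mul_factorial hkn]
      simp only [mul_assoc (G _)]
      have hs : (-1 : ℝ) ^ (m + 1) = (-1) ^ k * (-1) ^ (m + 1 - k) := by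
        rw [← pow_add, Nat.add_sub_cancel' hkn]
      rw [hs]
      push_cast
      ring
    rw [Finset.sum_range_succ, Finset.range_eq_Ico, Finset.sum_eq_sum_Ico_succ_bot (by omega)]
      at key
    simp only [hp0, Nat.sub_self, Nat.sub_zero, pow_zero, one_mul, mul_one, zero_add] at key
    rw [hsum, hψp, hlam']
    linear_combination (-1) ^ (m + 1) * ((m + 1).factorial : ℝ) * key
  exact ⟨by simpa using hrec 1 le_rfl, fun n hn => hrec n (by omega)⟩
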